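/- arXiv:1811.05444 — 2 statements merged into one kernel-verified Lean document; each statement's English description precedes it below -/
import Mathlib

section
/- A complete first-order theory T is unstable if and only if either some formula of T has the independence property or some formula of T has the strict order property of the second kind (SOP₂). -/
open FirstOrder

universe u v w

/-- φ(x̄,ȳ) has the order property (relative to T). -/
def HasOrderProperty {L : FirstOrder.Language.{u, v}} (T : L.Theory) {m n : ℕ}
    (φ : L.Formula (Fin m ⊕ Fin n)) : Prop :=
  ∃ (M : FirstOrder.Language.Theory.ModelType.{u, v, w} T)
    (a : ℕ → Fin m → M) (b : ℕ → Fin n → M),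
    ∀ i j : ℕ, (φ.Realize (Sum.elim (a i) (b j)) ↔ i < j)

/-- φ(x̄,ȳ) has the independence property (relative to T). -/
def HasIP {L : FirstOrder.Language.{u, v}} (T : L.Theory) {m n : ℕ}
    (φ : L.Formula (Fin m ⊕ Fin n)) : Prop :=
  ∃ (M : FirstOrder.Language.Theory.ModelType.{u, v, w} T) (b : ℕ → Fin n → M),
    ∀ uu vv : Finset ℕ, Disjoint uu vv →
      ∃ xx : Fin m → M, (∀ k ∈ uu, φ.Realize (Sum.elim xx (b k))) ∧
        (∀ k ∈ vv, ¬ φ.Realize (Sum.elim xx (b k)))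

/-- φ(x̄,ȳ) has the strict order property of the second kind, SOP₂ (relative to T). -/
def HasSOP2 {L : FirstOrder.Language.{u, v}} (T : L.Theory) {m n : ℕ}
    (φ : L.Formula (Fin m ⊕ Fin n)) : Prop :=
  ∃ (M : FirstOrder.Language.Theory.ModelType.{u, v, w} T) (b : List ℕ → Fin n → M),
    (∀ (η : ℕ → ℕ) (l : ℕ), ∃ xx : Fin m → M, ∀ k : ℕ, k < l →
        φ.Realize (Sum.elim xx (b ((List.range k).map η)))) ∧
    (∀ s t : List ℕ, ¬ s <+: t → ¬ t <+: s →
        ¬ ∃ xx : Fin m → M, φ.Realize (Sum.elim xx (b s)) ∧ φ.Realize (Sum.elim xx (b t)))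

section Helpers

/-- Iterated limit along the hyperfilter. -/
def ramLim (p : List ℕ → Prop) : ℕ → List ℕ → Prop
  | 0, s => p s
  | j + 1, s => ∀ᶠ n in (Filter.hyperfilter ℕ : Filter ℕ), ramLim p j (s ++ [n])

lemma ram_map_sublist (f : ℕ → ℕ) (hf : StrictMono f) (j : ℕ) :
    ((List.range j).map f).Sublist (List.range (f j)) := by
  induction j with
  | zero => simp
  | succ j ih =>
    rw [List.range_succ, List.map_append]
    have h1 : (List.range (f j + 1)).Sublist (List.range (f (j + 1))) :=
      List.range_sublist.2 (hf (Nat.lt_succ_self j))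
    refine List.Sublist.trans ?_ h1
    rw [List.range_succ]
    exact List.Sublist.append ih (List.Sublist.refl _)

/-- Ramsey's theorem for finitely many predicates. -/
lemma ramsey {ι : Type*} (W : Finset ι) (p : ι → List ℕ → Prop) (N : ℕ) :
    ∃ g : ℕ → ℕ, StrictMono g ∧ ∀ w ∈ W, ∀ f f' : ℕ → ℕ, StrictMono f → StrictMono f' →
      p w ((List.range N).map (fun i => g (f i))) →
      p w ((List.range N).map (fun i => g (f' i))) := by
  classical
  have step : ∀ l : List ℕ, ∃ n : ℕ, (∀ a ∈ l, a < n) ∧ ∀ w ∈ W, ∀ s ∈ l.sublists,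
      ∀ j ∈ Finset.range N, (ramLim (p w) j (s ++ [n]) ↔ ramLim (p w) (j + 1) s) := by
    intro l
    apply Filter.Eventually.exists (f := (Filter.hyperfilter ℕ : Filter ℕ))
    refine Filter.Eventually.and ?_ ?_
    · have : ∀ᶠ n in (Filter.hyperfilter ℕ : Filter ℕ), ∀ a ∈ l.toFinset, a < n := by
        rw [Filter.eventually_all_finset]
        intro a _
        exact Nat.hyperfilter_le_atTop (Filter.eventually_gt_atTop a)
      simpa using this
    · rw [Filter.eventually_all_finset]
      intro w _
      have : ∀ᶠ n in (Filter.hyperfilter ℕ : Filter ℕ), ∀ s ∈ l.sublists.toFinset,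
          ∀ j ∈ Finset.range N, (ramLim (p w) j (s ++ [n]) ↔ ramLim (p w) (j + 1) s) := by
        rw [Filter.eventually_all_finset]
        intro s _
        rw [Filter.eventually_all_finset]
        intro j _
        by_cases h : ramLim (p w) (j + 1) s
        · have h2 := h
          simp only [ramLim] at h2
          filter_upwards [h2] with n hn
          exact ⟨fun _ => h, fun _ => hn⟩
        · have h2 := h
          simp only [ramLim] at h2
          rw [← Ultrafilter.eventually_not] at h2
          filter_upwards [h2] with n hn
          exact ⟨fun h' => absurd h' hn, fun h' => absurd h' h⟩
      simpa only [List.mem_toFinset] using this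
  choose pick hpick1 hpick2 using step
  let G : ℕ → List ℕ := fun k => Nat.rec [] (fun _ l => l ++ [pick l]) k
  have hG : ∀ k, G (k + 1) = G k ++ [pick (G k)] := fun k => rfl
  let g : ℕ → ℕ := fun k => pick (G k)
  have hGg : ∀ k, G k = (List.range k).map g := by
    intro k
    induction k with
    | zero => rfl
    | succ k ih => rw [hG, List.range_succ, List.map_append, ← ih]; rfl
  have key : ∀ w ∈ W, ∀ f : ℕ → ℕ, StrictMono f → ∀ j, j ≤ N →
      (ramLim (p w) (N - j) ((List.range j).map (fun i => g (f i))) ↔ ramLim (p w) N []) := by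
    intro w hw f hf j
    induction j with
    | zero => intro _; simp
    | succ j ih =>
      intro hj
      rw [← ih (by omega)]
      have hs : ((List.range j).map (fun i => g (f i))) ∈ (G (f j)).sublists := by
        rw [List.mem_sublists, hGg]
        have := (ram_map_sublist f hf j).map g
        simpa [Function.comp_def] using this
      have := hpick2 (G (f j)) w hw _ hs (N - (j + 1)) (by simp; omega)
      rw [List.range_succ, List.map_append]
      rw [show N - j = N - (j + 1) + 1 by omega]
      exact this
  refine ⟨g, strictMono_nat_of_lt_succ ?_, ?_⟩
  · intro k
    apply hpick1 (G (k + 1))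
    rw [hG]
    simp [g]
  · intro w hw f f' hf hf' h
    have h1 := key w hw f hf N le_rfl
    have h2 := key w hw f' hf' N le_rfl
    rw [Nat.sub_self] at h1 h2
    exact h2.2 (h1.1 h)

/-- Combinatorial core: order property and a non-shattered bound give a definable chain. -/
lemma chain_of_order {A B : Type*} (R : A → B → Prop) (a : ℕ → A) (b : ℕ → B)
    (hab : ∀ i j, R (a i) (b j) ↔ i < j) (N : ℕ)
    (hN : ∀ c : ℕ → B, ∃ w ⊆ Finset.range N, ¬ ∃ x, ∀ i < N, (R x (c i) ↔ i ∈ w)) :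
    ∃ (w : Finset ℕ) (k : ℕ), ∀ n : ℕ, ∃ (c : ℕ → B) (d : ℕ → B), ∀ i j, i < j → j ≤ n →
      (∀ x, (∀ q < N, q ≠ k → q ≠ k + 1 → (R x (c q) ↔ q ∈ w)) → R x (d i) → R x (d j)) ∧
      (∃ x, (∀ q < N, q ≠ k → q ≠ k + 1 → (R x (c q) ↔ q ∈ w)) ∧ ¬ R x (d i) ∧ R x (d j)) := by
  classical
  obtain ⟨g, hg, hR⟩ := ramsey (Finset.range N).powerset
    (fun w s => ∃ x, ∀ i < N, (R x (b (s.getD i 0)) ↔ i ∈ w)) N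
  -- homogeneity
  have hom : ∀ w ⊆ Finset.range N, ∀ f f' : ℕ → ℕ, StrictMono f → StrictMono f' →
      (∃ x, ∀ i < N, (R x (b (g (f i))) ↔ i ∈ w)) →
      (∃ x, ∀ i < N, (R x (b (g (f' i))) ↔ i ∈ w)) := by
    intro w hw f f' hf hf' h
    have := hR w (Finset.mem_powerset.2 hw) f f' hf hf'
    have e : ∀ f : ℕ → ℕ, (∃ x, ∀ i < N, (R x (b (((List.range N).map (fun i => g (f i))).getD i 0)) ↔ i ∈ w))
        ↔ (∃ x, ∀ i < N, (R x (b (g (f i))) ↔ i ∈ w)) := by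
      intro f
      refine exists_congr fun x => forall_congr' fun i => ?_
      refine forall_congr' fun hi => ?_
      have : ((List.range N).map (fun i => g (f i))).getD i 0 = g (f i) := by
        simp [List.getD, hi]
      rw [this]
    rw [← e] at h ⊢
    exact this h
  -- the consistent patterns
  let C : Finset ℕ → Prop := fun w => ∃ x, ∀ i < N, (R x (b (g i)) ↔ i ∈ w)
  have hCf : ∀ w ⊆ Finset.range N, ∀ f : ℕ → ℕ, StrictMono f →
      (C w ↔ ∃ x, ∀ i < N, (R x (b (g (f i))) ↔ i ∈ w)) := by
    intro w hw f hf
    exact ⟨hom w hw id f strictMono_id hf, hom w hw f id hf strictMono_id⟩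
  obtain ⟨w0, hw0, hbad0⟩ := hN (fun i => b (g i))
  let bad := (Finset.range N).powerset.filter (fun w => ¬ C w)
  have hne : bad.Nonempty := ⟨w0, by simp only [bad, Finset.mem_filter, Finset.mem_powerset]; exact ⟨hw0, hbad0⟩⟩
  obtain ⟨w, hwb, hmax⟩ := Finset.exists_max_image bad (fun w => ∑ i ∈ w, i) hne
  simp only [bad, Finset.mem_filter, Finset.mem_powerset] at hwb hmax
  obtain ⟨hw, hCw⟩ := hwb
  -- a descent
  have hk : ∃ k, k ∈ w ∧ k + 1 < N ∧ k + 1 ∉ w := by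
    by_contra hcon
    push Not at hcon
    apply hCw
    have up : ∀ i ∈ w, ∀ j, i ≤ j → j < N → j ∈ w := by
      intro i hi j hij
      induction j, hij using Nat.le_induction with
      | base => intro _; exact hi
      | succ j _ ih => intro hj; exact hcon j (ih (by omega)) hj
    rw [hCf w hw (fun i => i + 1) (fun x y h => by simpa using h)]
    by_cases hemp : w.Nonempty
    · refine ⟨a (g (w.min' hemp)), fun i hi => ?_⟩
      rw [hab, hg.lt_iff_lt]
      constructor
      · intro h
        exact up _ (w.min'_mem hemp) i (by omega) hi
      · intro h
        have := w.min'_le i h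
        omega
    · rw [Finset.not_nonempty_iff_eq_empty] at hemp
      refine ⟨a (g N), fun i hi => ?_⟩
      rw [hab, hg.lt_iff_lt, hemp]
      simp; omega
  obtain ⟨k, hkw, hkN, hk1⟩ := hk
  let wswap := insert (k + 1) (w.erase k)
  have hswap : wswap ⊆ Finset.range N := by
    intro i hi
    simp only [wswap, Finset.mem_insert, Finset.mem_erase] at hi
    rcases hi with rfl | hi
    · simpa using hkN
    · exact hw hi.2
  have hCswap : C wswap := by
    by_contra hc
    have := hmax wswap ⟨hswap, hc⟩
    have e1 : ∑ i ∈ wswap, i = (k + 1) + ∑ i ∈ w.erase k, i :=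
      Finset.sum_insert (by simp [hk1])
    have e2 := Finset.add_sum_erase w (fun i => i) hkw
    omega
  refine ⟨w, k, fun n => ⟨fun q => b (g (if q < k then q else q + n)), fun i => b (g (k + i)), ?_⟩⟩
  intro i j hij hjn
  let f : ℕ → ℕ := fun q => if q < k then q else if q = k then k + i else
    if q = k + 1 then k + j else q + n
  have hf : StrictMono f := by
    apply strictMono_nat_of_lt_succ
    intro q
    simp only [f]
    split_ifs <;> omega
  have fk : f k = k + i := by simp [f]
  have fk1 : f (k + 1) = k + j := by simp [f]
  have fo : ∀ q, q ≠ k → q ≠ k + 1 → f q = if q < k then q else q + n := by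
    intro q h1 h2
    simp [f, h1, h2]
  constructor
  · intro x hx hi
    by_contra hj
    apply hCw
    rw [hCf w hw f hf]
    refine ⟨x, fun q hq => ?_⟩
    by_cases h1 : q = k
    · subst h1; rw [fk]; exact ⟨fun _ => hkw, fun _ => hi⟩
    by_cases h2 : q = k + 1
    · subst h2; rw [fk1]; exact ⟨fun h => absurd h hj, fun h => absurd h hk1⟩
    rw [fo q h1 h2]
    exact hx q hq h1 h2
  · rw [hCf wswap hswap f hf] at hCswap
    obtain ⟨x, hx⟩ := hCswap
    refine ⟨x, fun q hq h1 h2 => ?_, ?_, ?_⟩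
    · have := hx q hq
      rw [fo q h1 h2] at this
      rw [this]
      simp [wswap, h1, h2]
    · have := hx k (by omega)
      rw [fk] at this
      rw [this]
      simp [wswap]
    · have := hx (k + 1) hkN
      rw [fk1] at this
      rw [this]
      simp [wswap]

/-- Nested rational intervals. -/
def ivStep (p : ℚ × ℚ) (k : ℕ) : ℚ × ℚ :=
  (p.2 - (p.2 - p.1) / 2 ^ k, p.2 - (p.2 - p.1) / 2 ^ (k + 1))

def iv (p : ℚ × ℚ) (s : List ℕ) : ℚ × ℚ := s.foldl ivStep p

lemma ivStep_spec (p : ℚ × ℚ) (k : ℕ) (h : p.1 < p.2) :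
    p.1 ≤ (ivStep p k).1 ∧ (ivStep p k).1 < (ivStep p k).2 ∧ (ivStep p k).2 ≤ p.2 := by
  have hpos : 0 < p.2 - p.1 := by linarith
  simp only [ivStep]
  refine ⟨?_, ?_, ?_⟩
  · have := div_le_self hpos.le (one_le_pow₀ (M₀ := ℚ) (n := k) (by norm_num : (1 : ℚ) ≤ 2))
    linarith
  · have : (p.2 - p.1) / 2 ^ (k + 1) < (p.2 - p.1) / 2 ^ k :=
      div_lt_div_of_pos_left hpos (by positivity) (pow_lt_pow_right₀ (by norm_num) (by omega))
    linarith
  · have : 0 ≤ (p.2 - p.1) / 2 ^ (k + 1) := by positivity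
    linarith

lemma ivStep_disj (p : ℚ × ℚ) (k k' : ℕ) (h : p.1 < p.2) (hk : k < k') :
    (ivStep p k).2 ≤ (ivStep p k').1 := by
  have hpos : 0 < p.2 - p.1 := by linarith
  simp only [ivStep]
  have : (p.2 - p.1) / 2 ^ k' ≤ (p.2 - p.1) / 2 ^ (k + 1) :=
    div_le_div_of_nonneg_left hpos.le (by positivity) (pow_le_pow_right₀ (by norm_num) (by omega))
  linarith

lemma iv_spec (s : List ℕ) : ∀ p : ℚ × ℚ, p.1 < p.2 →
    p.1 ≤ (iv p s).1 ∧ (iv p s).1 < (iv p s).2 ∧ (iv p s).2 ≤ p.2 := by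
  induction s with
  | nil => intro p h; exact ⟨le_rfl, h, le_rfl⟩
  | cons k s ih =>
    intro p h
    obtain ⟨h1, h2, h3⟩ := ivStep_spec p k h
    obtain ⟨g1, g2, g3⟩ := ih (ivStep p k) h2
    exact ⟨h1.trans g1, g2, g3.trans h3⟩

lemma iv_disj (s : List ℕ) : ∀ (t : List ℕ) (p : ℚ × ℚ), p.1 < p.2 →
    ¬ s <+: t → ¬ t <+: s → (iv p s).2 ≤ (iv p t).1 ∨ (iv p t).2 ≤ (iv p s).1 := by
  induction s with
  | nil => intro t p _ h; exact absurd (List.nil_prefix) h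
  | cons k s ih =>
    intro t p hp h1 h2
    cases t with
    | nil => exact absurd (List.nil_prefix) h2
    | cons k' t =>
      have a1 := iv_spec s (ivStep p k) (ivStep_spec p k hp).2.1
      have a2 := iv_spec t (ivStep p k') (ivStep_spec p k' hp).2.1
      rcases lt_trichotomy k k' with hk | hk | hk
      · left
        exact a1.2.2.trans ((ivStep_disj p k k' hp hk).trans a2.1)
      · subst hk
        rw [List.cons_prefix_cons] at h1 h2
        exact ih t (ivStep p k) (ivStep_spec p k hp).2.1 (fun h => h1 ⟨rfl, h⟩)
          (fun h => h2 ⟨rfl, h⟩)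
      · right
        exact a2.2.2.trans ((ivStep_disj p k' k hp hk).trans a1.1)

open FirstOrder.Language

/-- Compactness inside the universe of the given model, via ultrapowers. -/
lemma ultra_compact {L : FirstOrder.Language.{u, v}} (T : L.Theory)
    (M : FirstOrder.Language.Theory.ModelType.{u, v, w} T) {V J : Type} (χ : J → L.Formula V)
    (h : ∀ F : Finset J, ∃ x : V → M, ∀ j ∈ F, (χ j).Realize x) :
    ∃ (N : FirstOrder.Language.Theory.ModelType.{u, v, w} T) (x : V → N),
      ∀ j, (χ j).Realize x := by
  classical
  choose x hx using h
  let U : Ultrafilter (Finset J) := Ultrafilter.of Filter.atTop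
  let P : Type w := (U : Filter (Finset J)).Product (fun _ => (M : Type w))
  have : P ⊨ T := by
    refine ⟨fun φ hφ => ?_⟩
    refine (Ultraproduct.sentence_realize (M := fun _ : Finset J => (M : Type w)) (u := U) φ).2 ?_
    exact Filter.Eventually.of_forall fun _ => T.realize_sentence_of_mem hφ
  have : Nonempty P := Ultraproduct.Product.instNonempty
  refine ⟨FirstOrder.Language.Theory.ModelType.of T P,
    fun i => ((fun F => x F i : (F : Finset J) → (M : Type w)) : P), fun j => ?_⟩
  refine (Ultraproduct.realize_formula_cast (M := fun _ : Finset J => (M : Type w)) (u := U)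
    (χ j) (fun i F => x F i)).2 ?_
  have h1 : ∀ᶠ F in (U : Filter (Finset J)), {j} ≤ F :=
    Ultrafilter.of_le _ (Filter.eventually_ge_atTop _)
  filter_upwards [h1] with F hF
  exact hx F j (by simpa using hF)

/-- Put the parameters at index i of a family. -/
noncomputable def atIdx {L : FirstOrder.Language.{u, v}} {α β I : Type} (φ : L.Formula (α ⊕ β)) (i : I) :
    L.Formula ((I × β) ⊕ α) :=
  φ.relabel (Sum.elim Sum.inr (fun y => Sum.inl (i, y)))

lemma realize_atIdx {L : FirstOrder.Language.{u, v}} {α β I : Type} (φ : L.Formula (α ⊕ β)) (i : I)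
    {M : Type w} [L.Structure M] (z : I × β → M) (x : α → M) :
    (atIdx φ i).Realize (Sum.elim z x) ↔ φ.Realize (Sum.elim x (fun y => z (i, y))) := by
  rw [atIdx, Formula.realize_relabel]
  have : (Sum.elim z x ∘ Sum.elim Sum.inr fun y => Sum.inl (i, y)) =
      Sum.elim x (fun y => z (i, y)) := by
    ext t; rcases t with t | t <;> rfl
  rw [this]


lemma ip_to_op {L : FirstOrder.Language.{u, v}} (T : L.Theory) {m n : ℕ}
    (φ : L.Formula (Fin m ⊕ Fin n)) (h : HasIP.{u, v, w} T φ) : HasOrderProperty.{u, v, w} T φ := by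
  classical
  obtain ⟨M, b, hb⟩ := h
  let ρ : ℕ × ℕ → Fin m ⊕ Fin n → (ℕ × Fin m) ⊕ (ℕ × Fin n) :=
    fun p => Sum.map (fun y => (p.1, y)) (fun y => (p.2, y))
  let χ : ℕ × ℕ → L.Formula ((ℕ × Fin m) ⊕ (ℕ × Fin n)) := fun p =>
    if p.1 < p.2 then φ.relabel (ρ p) else ∼(φ.relabel (ρ p))
  have hχ : ∀ (N : Type w) [L.Structure N] (z : (ℕ × Fin m) ⊕ (ℕ × Fin n) → N) (p : ℕ × ℕ),
      (χ p).Realize z ↔ (φ.Realize (Sum.elim (fun y => z (Sum.inl (p.1, y)))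
        (fun y => z (Sum.inr (p.2, y)))) ↔ p.1 < p.2) := by
    intro N _ z p
    have e : z ∘ ρ p = Sum.elim (fun y => z (Sum.inl (p.1, y))) (fun y => z (Sum.inr (p.2, y))) := by
      ext t; rcases t with t | t <;> rfl
    by_cases hp : p.1 < p.2
    · simp only [χ, hp, if_true, Formula.realize_relabel, e, iff_true]
    · simp only [χ, hp, if_false, Formula.realize_not, Formula.realize_relabel, e, iff_false]
  obtain ⟨N, z, hz⟩ := ultra_compact T M χ (by
    intro F
    let K := F.sup (fun p => p.2) + 1
    have hx : ∀ i : ℕ, ∃ x : Fin m → M, ∀ j < K, (φ.Realize (Sum.elim x (b j)) ↔ i < j) := by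
      intro i
      obtain ⟨x, h1, h2⟩ := hb ((Finset.range K).filter (fun j => i < j))
        ((Finset.range K).filter (fun j => ¬ i < j)) (Finset.disjoint_filter_filter_not _ _ _)
      refine ⟨x, fun j hj => ?_⟩
      by_cases hij : i < j
      · exact ⟨fun _ => hij, fun _ => h1 j (by simp [hj, hij])⟩
      · exact ⟨fun h => absurd h (h2 j (by simp [hj]; omega)), fun h => absurd h hij⟩
    choose x hx using hx
    refine ⟨Sum.elim (fun q => x q.1 q.2) (fun q => b q.1 q.2), fun p hp => ?_⟩
    rw [hχ]
    exact hx p.1 p.2 (Nat.lt_succ_of_le (Finset.le_sup (f := fun p : ℕ × ℕ => p.2) hp)))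
  exact ⟨N, fun i y => z (Sum.inl (i, y)), fun j y => z (Sum.inr (j, y)),
    fun i j => (hχ N z (i, j)).1 (hz (i, j))⟩

lemma sop2_to_op {L : FirstOrder.Language.{u, v}} (T : L.Theory) {m n : ℕ}
    (φ : L.Formula (Fin m ⊕ Fin n)) (h : HasSOP2.{u, v, w} T φ) :
    HasOrderProperty.{u, v, w} T (φ.relabel Sum.swap : L.Formula (Fin n ⊕ Fin m)) := by
  obtain ⟨M, b, hb1, hb2⟩ := h
  -- the zero branch and points leaving it
  have hx : ∀ i : ℕ, ∃ x : Fin m → M, (∀ k ≤ i, φ.Realize (Sum.elim x (b (List.replicate k 0)))) ∧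
      φ.Realize (Sum.elim x (b (List.replicate i 0 ++ [1]))) := by
    intro i
    obtain ⟨x, hx⟩ := hb1 (fun q => if q < i then 0 else 1) (i + 2)
    have e : ∀ k ≤ i, (List.range k).map (fun q => if q < i then 0 else 1) = List.replicate k 0 := by
      intro k hk
      rw [List.eq_replicate_iff]
      refine ⟨by simp, fun c hc => ?_⟩
      simp only [List.mem_map, List.mem_range] at hc
      obtain ⟨q, hq, rfl⟩ := hc
      simp; omega
    refine ⟨x, fun k hk => ?_, ?_⟩
    · have := hx k (by omega)
      rwa [e k hk] at this
    · have := hx (i + 1) (by omega)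
      rw [List.range_succ, List.map_append, e i le_rfl] at this
      simpa using this
  choose x hx1 hx2 using hx
  refine ⟨M, fun i => b (List.replicate (i + 1) 0), fun j => x j, fun i j => ?_⟩
  rw [Formula.realize_relabel]
  have e : (Sum.elim (b (List.replicate (i + 1) 0)) (x j) ∘ Sum.swap : Fin m ⊕ Fin n → M) =
      Sum.elim (x j) (b (List.replicate (i + 1) 0)) := by
    ext t; rcases t with t | t <;> rfl
  rw [e]
  constructor
  · intro h
    by_contra hij
    have hpre : ¬ (List.replicate (i + 1) 0 <+: List.replicate j 0 ++ [1]) ∧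
        ¬ (List.replicate j 0 ++ [1] <+: List.replicate (i + 1) 0) := by
      have e2 : List.replicate (i + 1) 0 = List.replicate j 0 ++ (0 :: List.replicate (i - j) 0) := by
        rw [← List.replicate_succ, List.replicate_append_replicate]
        congr 1; omega
      rw [e2, List.prefix_append_right_inj, List.prefix_append_right_inj, List.cons_prefix_cons,
        List.cons_prefix_cons]
      simp
    exact hb2 _ _ hpre.1 hpre.2 ⟨x j, h, hx2 j⟩
  · intro hij
    exact hx1 j (i + 1) hij

lemma bound_of_not_ip {L : FirstOrder.Language.{u, v}} (T : L.Theory) {m n : ℕ}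
    (φ : L.Formula (Fin m ⊕ Fin n)) (h : ¬ HasIP.{u, v, w} T φ)
    (M : FirstOrder.Language.Theory.ModelType.{u, v, w} T) :
    ∃ N : ℕ, ∀ c : ℕ → Fin n → M, ∃ s ⊆ Finset.range N,
      ¬ ∃ x : Fin m → M, ∀ i < N, (φ.Realize (Sum.elim x (c i)) ↔ i ∈ s) := by
  classical
  by_contra hcon
  push Not at hcon
  apply h
  let χ : ℕ × Finset ℕ → L.Formula (ℕ × Fin n) := fun p =>
    Formula.iExs (Fin m) (Formula.iInf (fun i : Fin p.1 =>
      if i.1 ∈ p.2 then atIdx φ i.1 else ∼(atIdx φ i.1)))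
  have hχ : ∀ (N : Type w) [L.Structure N] (z : ℕ × Fin n → N) (p : ℕ × Finset ℕ),
      (χ p).Realize z ↔ ∃ x : Fin m → N, ∀ i < p.1,
        (φ.Realize (Sum.elim x (fun y => z (i, y))) ↔ i ∈ p.2) := by
    intro N _ z p
    simp only [χ, Formula.realize_iExs, Formula.realize_iInf]
    refine exists_congr fun x => ?_
    have key : ∀ i : ℕ, ((if i ∈ p.2 then atIdx φ i else ∼(atIdx φ i)).Realize (Sum.elim z x) ↔
        (φ.Realize (Sum.elim x (fun y => z (i, y))) ↔ i ∈ p.2)) := by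
      intro i
      by_cases hi : i ∈ p.2
      · simp only [hi, if_true, realize_atIdx, iff_true]
      · simp only [hi, if_false, Formula.realize_not, realize_atIdx, iff_false]
    exact ⟨fun h i hi => (key i).1 (h ⟨i, hi⟩), fun h i => (key i).2 (h i.1 i.2)⟩
  obtain ⟨N, z, hz⟩ := ultra_compact T M χ (by
    intro F
    obtain ⟨c, hc⟩ := hcon (F.sup (fun p => p.1))
    refine ⟨fun q => c q.1 q.2, fun p hp => ?_⟩
    rw [hχ]
    have hle : p.1 ≤ F.sup (fun p => p.1) := Finset.le_sup (f := fun p : ℕ × Finset ℕ => p.1) hp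
    obtain ⟨x, hx⟩ := hc (p.2 ∩ Finset.range p.1) (by
      intro i hi
      simp only [Finset.mem_inter, Finset.mem_range] at hi ⊢
      omega)
    refine ⟨x, fun i hi => ?_⟩
    rw [hx i (by omega)]
    simp [hi])
  refine ⟨N, fun i y => z (i, y), fun uu vv hd => ?_⟩
  obtain ⟨x, hx⟩ := (hχ N z ((uu ∪ vv).sup id + 1, uu)).1 (hz _)
  refine ⟨x, fun k hk => ?_, fun k hk => ?_⟩
  · exact (hx k (Nat.lt_succ_of_le (Finset.le_sup (f := id) (Finset.mem_union_left _ hk)))).2 hk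
  · rw [hx k (Nat.lt_succ_of_le (Finset.le_sup (f := id) (Finset.mem_union_right _ hk)))]
    exact Finset.disjoint_right.1 hd hk

lemma sop2_of_chain {L : FirstOrder.Language.{u, v}} (T : L.Theory) {m : ℕ} {γ : Type} [Finite γ]
    (ψ : L.Formula (Fin m ⊕ γ)) (M : FirstOrder.Language.Theory.ModelType.{u, v, w} T)
    (h : ∀ n : ℕ, ∃ d : ℕ → γ → M, ∀ i j, i < j → j ≤ n →
      (∀ x : Fin m → M, ψ.Realize (Sum.elim x (d i)) → ψ.Realize (Sum.elim x (d j))) ∧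
      (∃ x : Fin m → M, ¬ ψ.Realize (Sum.elim x (d i)) ∧ ψ.Realize (Sum.elim x (d j)))) :
    ∃ (n : ℕ) (φ : L.Formula (Fin m ⊕ Fin n)), HasSOP2.{u, v, w} T φ := by
  classical
  let χ : ℚ × ℚ → L.Formula (ℚ × γ) := fun p => if p.1 < p.2 then
    Formula.iAlls (Fin m) ((atIdx ψ p.1).imp (atIdx ψ p.2)) ⊓
      Formula.iExs (Fin m) (∼(atIdx ψ p.1) ⊓ atIdx ψ p.2) else ⊤
  have hχ : ∀ (N : Type w) [L.Structure N] (z : ℚ × γ → N) (p : ℚ × ℚ),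
      (χ p).Realize z ↔ (p.1 < p.2 →
        (∀ x : Fin m → N, ψ.Realize (Sum.elim x (fun y => z (p.1, y))) →
          ψ.Realize (Sum.elim x (fun y => z (p.2, y)))) ∧
        (∃ x : Fin m → N, ¬ ψ.Realize (Sum.elim x (fun y => z (p.1, y))) ∧
          ψ.Realize (Sum.elim x (fun y => z (p.2, y))))) := by
    intro N _ z p
    by_cases hp : p.1 < p.2
    · simp only [χ, hp, if_true, Formula.realize_inf, Formula.realize_iAlls, Formula.realize_iExs,
        Formula.realize_imp, Formula.realize_not, realize_atIdx, true_imp_iff]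
    · simp only [χ, hp, if_false, Formula.realize_top, false_imp_iff]
  obtain ⟨N, z, hz⟩ := ultra_compact T M χ (by
    intro F
    let S : Finset ℚ := F.image Prod.fst ∪ F.image Prod.snd
    obtain ⟨d, hd⟩ := h S.card
    let rk : ℚ → ℕ := fun q => (S.filter (fun s => s < q)).card
    refine ⟨fun q => d (rk q.1) q.2, fun p hp => ?_⟩
    rw [hχ]
    intro hlt
    refine hd (rk p.1) (rk p.2) ?_ (Finset.card_filter_le _ _)
    apply Finset.card_lt_card
    rw [Finset.ssubset_iff_of_subset (by
      intro s hs
      simp only [Finset.mem_filter] at hs ⊢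
      exact ⟨hs.1, hs.2.trans hlt⟩)]
    refine ⟨p.1, ?_, by simp⟩
    simp only [Finset.mem_filter]
    exact ⟨Finset.mem_union_left _ (Finset.mem_image_of_mem _ hp), hlt⟩)
  have hz' := fun q r => (hχ N z (q, r)).1 (hz (q, r))
  simp only at hz'
  have mono : ∀ q r : ℚ, q ≤ r → ∀ x : Fin m → N, ψ.Realize (Sum.elim x (fun y => z (q, y))) →
      ψ.Realize (Sum.elim x (fun y => z (r, y))) := by
    intro q r hqr x hx
    rcases hqr.eq_or_lt with rfl | hlt
    · exact hx
    · exact (hz' q r hlt).1 x hx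
  obtain ⟨n, ⟨e⟩⟩ := Finite.exists_equiv_fin (γ ⊕ γ)
  let φ : L.Formula (Fin m ⊕ Fin n) :=
    ∼(ψ.relabel (Sum.map id (fun y => e (Sum.inl y)))) ⊓
      ψ.relabel (Sum.map id (fun y => e (Sum.inr y)))
  let b : List ℕ → Fin n → N := fun s t =>
    Sum.elim (fun y => z ((iv (0, 1) s).1, y)) (fun y => z ((iv (0, 1) s).2, y)) (e.symm t)
  have hφ : ∀ (x : Fin m → N) (s : List ℕ), φ.Realize (Sum.elim x (b s)) ↔
      (¬ ψ.Realize (Sum.elim x (fun y => z ((iv (0, 1) s).1, y))) ∧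
        ψ.Realize (Sum.elim x (fun y => z ((iv (0, 1) s).2, y)))) := by
    intro x s
    have e1 : (Sum.elim x (b s) ∘ Sum.map id (fun y => e (Sum.inl y)) : Fin m ⊕ γ → N) =
        Sum.elim x (fun y => z ((iv (0, 1) s).1, y)) := by
      ext t; rcases t with t | t <;> simp [b]
    have e2 : (Sum.elim x (b s) ∘ Sum.map id (fun y => e (Sum.inr y)) : Fin m ⊕ γ → N) =
        Sum.elim x (fun y => z ((iv (0, 1) s).2, y)) := by
      ext t; rcases t with t | t <;> simp [b]
    simp only [φ, Formula.realize_inf, Formula.realize_not, Formula.realize_relabel, e1, e2]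
  have h01 : ((0, 1) : ℚ × ℚ).1 < ((0, 1) : ℚ × ℚ).2 := by norm_num
  refine ⟨n, φ, N, b, ?_, ?_⟩
  · intro η l
    obtain ⟨x, hx1, hx2⟩ := (hz' _ _ (iv_spec ((List.range l).map η) (0, 1) h01).2.1).2
    refine ⟨x, fun k hk => ?_⟩
    rw [hφ]
    obtain ⟨t, ht⟩ : (List.range k).map η <+: (List.range l).map η := by
      apply List.IsPrefix.map
      refine ⟨(List.range (l - k)).map (fun i => k + i), ?_⟩
      rw [← List.range_add]
      congr 1; omega
    have e3 : iv (0, 1) ((List.range l).map η) = iv (iv (0, 1) ((List.range k).map η)) t := by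
      rw [← ht]; simp only [iv, List.foldl_append]
    have hs := iv_spec t _ (iv_spec ((List.range k).map η) (0, 1) h01).2.1
    rw [← e3] at hs
    exact ⟨fun h => hx1 (mono _ _ hs.1 x h), mono _ _ hs.2.2 x hx2⟩
  · rintro s t h1 h2 ⟨x, hs, ht⟩
    rw [hφ] at hs ht
    rcases iv_disj s t (0, 1) h01 h1 h2 with h | h
    · exact ht.1 (mono _ _ h x hs.2)
    · exact hs.1 (mono _ _ h x ht.2)

lemma op_to_sop2 {L : FirstOrder.Language.{u, v}} (T : L.Theory) {m n : ℕ}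
    (φ : L.Formula (Fin m ⊕ Fin n)) (h : HasOrderProperty.{u, v, w} T φ)
    (hip : ¬ HasIP.{u, v, w} T φ) :
    ∃ (n' : ℕ) (φ' : L.Formula (Fin m ⊕ Fin n')), HasSOP2.{u, v, w} T φ' := by
  classical
  obtain ⟨M, a, b, hab⟩ := h
  obtain ⟨N, hN⟩ := bound_of_not_ip T φ hip M
  obtain ⟨s, k, hch⟩ := chain_of_order (fun (x : Fin m → M) (y : Fin n → M) =>
    φ.Realize (Sum.elim x y)) a b hab N hN
  let atOpt : Option (Fin N) → L.Formula (Fin m ⊕ (Option (Fin N) × Fin n)) := fun o =>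
    φ.relabel (Sum.map id (fun y => (o, y)))
  let ψ : L.Formula (Fin m ⊕ (Option (Fin N) × Fin n)) := atOpt none ⊓
    Formula.iInf (fun q : Fin N => if q.1 = k ∨ q.1 = k + 1 then ⊤ else
      if q.1 ∈ s then atOpt (some q) else ∼(atOpt (some q)))
  refine sop2_of_chain T ψ M fun K => ?_
  obtain ⟨c, d, hcd⟩ := hch K
  let par : ℕ → Option (Fin N) × Fin n → M := fun i p =>
    match p with
    | (none, y) => d i y
    | (some q, y) => c q.1 y
  have hψ : ∀ (x : Fin m → M) (i : ℕ), ψ.Realize (Sum.elim x (par i)) ↔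
      (φ.Realize (Sum.elim x (d i)) ∧
        ∀ q < N, q ≠ k → q ≠ k + 1 → (φ.Realize (Sum.elim x (c q)) ↔ q ∈ s)) := by
    intro x i
    have e0 : (atOpt none).Realize (Sum.elim x (par i)) ↔ φ.Realize (Sum.elim x (d i)) := by
      simp only [atOpt, Formula.realize_relabel]
      have : (Sum.elim x (par i) ∘ Sum.map id (fun y => (none, y)) : Fin m ⊕ Fin n → M) =
          Sum.elim x (d i) := by
        ext t; rcases t with t | t <;> rfl
      rw [this]
    have e1 : ∀ q : Fin N, (atOpt (some q)).Realize (Sum.elim x (par i)) ↔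
        φ.Realize (Sum.elim x (c q.1)) := by
      intro q
      simp only [atOpt, Formula.realize_relabel]
      have : (Sum.elim x (par i) ∘ Sum.map id (fun y => (some q, y)) : Fin m ⊕ Fin n → M) =
          Sum.elim x (c q.1) := by
        ext t; rcases t with t | t <;> rfl
      rw [this]
    simp only [ψ, Formula.realize_inf, Formula.realize_iInf, e0]
    refine and_congr_right fun _ => ?_
    have key : ∀ q : Fin N, ((if q.1 = k ∨ q.1 = k + 1 then ⊤ else
      if q.1 ∈ s then atOpt (some q) else ∼(atOpt (some q))).Realize (Sum.elim x (par i)) ↔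
        (q.1 ≠ k → q.1 ≠ k + 1 → (φ.Realize (Sum.elim x (c q.1)) ↔ q.1 ∈ s))) := by
      intro q
      by_cases h1 : q.1 = k
      · simp [h1]
      by_cases h2 : q.1 = k + 1
      · simp [h2]
      by_cases h3 : q.1 ∈ s
      · simp [h1, h2, h3, e1]
      · simp [h1, h2, h3, e1]
    exact ⟨fun h q hq => (key ⟨q, hq⟩).1 (h ⟨q, hq⟩), fun h q => (key q).2 (h q.1 q.2)⟩
  refine ⟨par, fun i j hij hjK => ?_⟩
  obtain ⟨h1, x, hx, hx1, hx2⟩ := hcd i j hij hjK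
  refine ⟨fun x hx => ?_, x, ?_, ?_⟩
  · rw [hψ] at hx ⊢
    exact ⟨h1 x hx.2 hx.1, hx.2⟩
  · rw [hψ]; exact fun h => hx1 h.1
  · rw [hψ]; exact ⟨hx2, hx⟩

end Helpers

theorem statement5 {L : FirstOrder.Language.{u, v}} (T : L.Theory) (hT : T.IsComplete) :
    (∃ (m n : ℕ) (φ : L.Formula (Fin m ⊕ Fin n)), HasOrderProperty.{u, v, w} T φ) ↔
      ((∃ (m n : ℕ) (φ : L.Formula (Fin m ⊕ Fin n)), HasIP.{u, v, w} T φ) ∨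
        (∃ (m n : ℕ) (φ : L.Formula (Fin m ⊕ Fin n)), HasSOP2.{u, v, w} T φ)) := by
  constructor
  · rintro ⟨m, n, φ, h⟩
    by_cases hip : HasIP.{u, v, w} T φ
    · exact Or.inl ⟨m, n, φ, hip⟩
    · exact Or.inr ⟨m, op_to_sop2 T φ h hip⟩
  · rintro (⟨m, n, φ, h⟩ | ⟨m, n, φ, h⟩)
    · exact ⟨m, n, φ, ip_to_op T φ h⟩
    · exact ⟨n, m, _, sop2_to_op T φ h⟩
end

section
/- Let B be a complete Boolean algebra, write λ = c.c.(B), and let U be a nonprincipal ultrafilter on B. Then there is a (λ, Δ(TP₂))-distribution A in U such that whenever e : B → B* is a complete embedding of B into a complete Boolean algebra B* that has the λ-c.c. (every antichain of B* has cardinality < λ), the λ-distribution s ↦ e(A(s)) has no multiplicative refinement in B*: there is no multiplicative λ-distribution D in B* with D(s) ≤ e(A(s)) for all finite s ⊆ λ. -/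
universe u v

section BA

variable {B : Type u} [CompleteBooleanAlgebra B]

/-- U is an ultrafilter on the complete Boolean algebra B. -/
def IsUltra (U : Set B) : Prop :=
  ⊤ ∈ U ∧ ⊥ ∉ U ∧ (∀ a ∈ U, ∀ b : B, a ≤ b → b ∈ U) ∧
    (∀ a ∈ U, ∀ b ∈ U, a ⊓ b ∈ U) ∧ ∀ a : B, a ∈ U ∨ aᶜ ∈ U

/-- c decides b if c ≤ b or c ≤ bᶜ. -/
def Decides (c b : B) : Prop := c ≤ b ∨ c ≤ bᶜ

/-- A λ-distribution (with index set ι of cardinality λ): a map from finite subsets of λ to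
the nonzero elements of B, sending ∅ to ⊤ and reversing inclusions. -/
def IsDistribution {ι : Type*} (A : Finset ι → B) : Prop :=
  (∀ s, A s ≠ ⊥) ∧ A ∅ = ⊤ ∧ ∀ s t : Finset ι, t ⊆ s → A s ≤ A t

/-- A distribution is multiplicative if A(s) = ⨅_{α∈s} A({α}). -/
def IsMultiplicative {ι : Type*} (A : Finset ι → B) : Prop :=
  ∀ s : Finset ι, A s = s.inf (fun α => A {α})

/-- A family (a_α)_{α<λ} is λ-regular: finite subfamilies have nonzero meet, infinite
subfamilies have meet ⊥, and the nonzero elements deciding every a_α are dense in B₊. -/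
def IsRegularFamily {ι : Type*} (a : ι → B) : Prop :=
  (∀ s : Finset ι, s.inf a ≠ ⊥) ∧
  (∀ X : Set ι, X.Infinite → (⨅ α ∈ X, a α) = ⊥) ∧
  (∀ b : B, b ≠ ⊥ → ∃ c : B, c ≠ ⊥ ∧ c ≤ b ∧ ∀ α : ι, Decides c (a α))

/-- A name for a natural number: a map n : ω → B with pairwise disjoint values
whose supremum is ⊤. -/
def IsName (nm : ℕ → B) : Prop :=
  (∀ i j : ℕ, i ≠ j → Disjoint (nm i) (nm j)) ∧ (⨆ m : ℕ, nm m) = ⊤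

/-- ‖n ≥ m‖ := ⨆_{j≥m} n(j). -/
def nameGe (nm : ℕ → B) (m : ℕ) : B := ⨆ j : ℕ, ⨆ _ : m ≤ j, nm j

/-- n is U-nonstandard if ‖n ≥ m‖ ∈ U for every m. -/
def IsNonstandardName (U : Set B) (nm : ℕ → B) : Prop := ∀ m : ℕ, nameGe nm m ∈ U

/-- U is ℵ₁-incomplete: some decreasing ω-sequence from U has infimum ⊥. -/
def Aleph1Incomplete (U : Set B) : Prop :=
  ∃ c : ℕ → B, (∀ k, c k ∈ U) ∧ Antitone c ∧ (⨅ k : ℕ, c k) = ⊥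


/-- An antichain in B: a set of pairwise-disjoint nonzero elements. -/
def IsAntichainIn {B : Type*} [CompleteBooleanAlgebra B] (A : Set B) : Prop :=
  (∀ a ∈ A, a ≠ ⊥) ∧ A.Pairwise (fun a b => a ⊓ b = ⊥)

/-- c.c.(B): the least cardinal κ such that B has no antichain of cardinality κ. -/
noncomputable def ccOf (B : Type u) [CompleteBooleanAlgebra B] : Cardinal.{u} :=
  sInf {κ : Cardinal.{u} | ¬ ∃ A : Set B, IsAntichainIn A ∧ Cardinal.mk A = κ}

/-- A is a (λ, Δ)-distribution: for every finite s ⊆ λ and nonzero c deciding A(t) for all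
t ⊆ s, there is f : s → I with, for all t ⊆ s, c ≤ A(t) iff f[t] ∈ Δ. -/
def IsDeltaDistribution {B : Type*} [CompleteBooleanAlgebra B] {ι : Type*} {I : Type*}
    (A : Finset ι → B) (Δ : Set (Finset I)) : Prop :=
  ∀ (s : Finset ι) (c : B), c ≠ ⊥ → (∀ t ⊆ s, Decides c (A t)) →
    ∃ f : ι → I, ∀ t ⊆ s, (c ≤ A t ↔ (letI := Classical.decEq I; t.image f) ∈ Δ)

/-- A complete embedding of complete Boolean algebras: an injective homomorphism preserving
arbitrary suprema and infima. -/
def IsCompleteEmbedding {B : Type*} {B' : Type*} [CompleteBooleanAlgebra B]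
    [CompleteBooleanAlgebra B'] (e : B → B') : Prop :=
  Function.Injective e ∧ (∀ a b : B, e (a ⊓ b) = e a ⊓ e b) ∧
    (∀ a b : B, e (a ⊔ b) = e a ⊔ e b) ∧ (∀ a : B, e aᶜ = (e a)ᶜ) ∧
    (∀ S : Set B, e (sSup S) = sSup (e '' S)) ∧ (∀ S : Set B, e (sInf S) = sInf (e '' S))

/-- The pattern Δ(TP₂) on ω × ω: finite graphs of partial functions from ω to ω. -/
def deltaTP2 : Set (Finset (ℕ × ℕ)) :=
  {s | ∀ n m m' : ℕ, (n, m) ∈ s → (n, m') ∈ s → m = m'}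

open Cardinal in
theorem aux_comb {ι P : Type u} [LinearOrder ι] [WellFoundedLT ι]
    (hb : ∀ s : Set ι, #s < #ι → ∃ x, ∀ y ∈ s, y < x)
    (hfin : ∀ x : ι, #(Set.Iic x) < #ι) (hinf : ℵ₀ ≤ #ι)
    [LinearOrder P] [WellFoundedLT P] (hP : #P < #ι) (K : Set P) (hne : K.Nonempty)
    (hmax : ∀ j ∈ K, ∃ j' ∈ K, j < j') :
    ∃ g : P → ι → ι ⊕ ι,
      (∀ x y, x ≠ y → ∃ i₀ ∈ K, ∀ i ∈ K, i₀ ≤ i → g i x ≠ g i y) ∧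
      ∀ h : ι → P, ∃ i v, #{x | h x = i ∧ g i x = v} = #ι := by
  classical
  let S : ι → (P → ι) → Prop := fun x C =>
    (∀ i, C i < x) ∧ ∀ c < x, ∃ i₀ ∈ K, ∀ i ∈ K, i₀ ≤ i → c ≤ C i
  let g : P → ι → ι ⊕ ι := fun i x =>
    if hx : ∃ C, S x C then Sum.inl (hx.choose i) else Sum.inr x
  have key : ∀ x y, x < y → (∃ C, S x C) → (∃ C, S y C) →
      ∃ i₀ ∈ K, ∀ i ∈ K, i₀ ≤ i → g i x ≠ g i y := by
    intro x y hxy hx hy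
    obtain ⟨i₀, h0, h1⟩ := hy.choose_spec.2 x hxy
    refine ⟨i₀, h0, fun i hi hle heq => ?_⟩
    have h2 := hx.choose_spec.1 i
    have h3 := h1 i hi hle
    simp only [g, dif_pos hx, dif_pos hy, Sum.inl.injEq] at heq
    exact absurd (heq ▸ h2) (not_lt.mpr h3)
  refine ⟨g, ?_, ?_⟩
  · intro x y hxy
    by_cases hx : ∃ C, S x C <;> by_cases hy : ∃ C, S y C
    · rcases lt_or_gt_of_ne hxy with h | h
      · exact key x y h hx hy
      · obtain ⟨i₀, h0, h1⟩ := key y x h hy hx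
        exact ⟨i₀, h0, fun i hi hle => (h1 i hi hle).symm⟩
    all_goals
      obtain ⟨k, hk⟩ := hne
      refine ⟨k, hk, fun i hi hle => ?_⟩
      simp [g, hx, hy, hxy]
  · intro h
    by_contra hcon
    push Not at hcon
    have hlt : ∀ i v, ∃ b, ∀ x ∈ {x | h x = i ∧ g i x = v}, x < b := fun i v =>
      hb _ (lt_of_le_of_ne (mk_set_le _) (hcon i v))
    choose f hf using hlt
    have hG : ∀ a : ι, ∃ b, a < b ∧ ∀ i, ∀ c ≤ a, f i (Sum.inl c) < b := by
      intro a
      obtain ⟨x, hx⟩ := hb (Set.range fun p : P × Set.Iic a => f p.1 (Sum.inl p.2.1)) (by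
        refine lt_of_le_of_lt mk_range_le ?_
        rw [mk_prod, lift_id, lift_id]
        exact mul_lt_of_lt hinf hP (hfin a))
      obtain ⟨y, hy⟩ := hb {a} (by
        rw [mk_singleton]; exact lt_of_lt_of_le one_lt_aleph0 hinf)
      refine ⟨max x y, lt_max_of_lt_right (hy a rfl), fun i c hc => lt_max_of_lt_left ?_⟩
      exact hx _ ⟨(i, ⟨c, hc⟩), rfl⟩
    choose G hG1 hG2 using hG
    have hbb : ∀ s : Set ι, ∃ x, #s < #ι → ∀ y ∈ s, y < x := by
      intro s
      by_cases hs : #s < #ι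
      · obtain ⟨x, hx⟩ := hb s hs
        exact ⟨x, fun _ => hx⟩
      · obtain ⟨k, _⟩ := hne
        exact ⟨f k (Sum.inr ((mk_ne_zero_iff.mp (aleph0_pos.trans_le hinf).ne').some)),
          fun h => absurd h hs⟩
    choose bnd hbnd using hbb
    let a : P → ι := (wellFounded_lt (α := P)).fix
      (fun j rec => bnd (Set.range fun j' : Set.Iio j => G (rec j'.1 j'.2)))
    have ha : ∀ j j', j' < j → G (a j') < a j := by
      intro j j' hj
      have h1 : a j = bnd (Set.range fun j' : Set.Iio j => G (a j'.1)) :=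
        WellFounded.fix_eq _ _ _
      rw [h1]
      refine hbnd _ ?_ _ ⟨⟨j', hj⟩, rfl⟩
      exact (mk_range_le.trans (mk_set_le _)).trans_lt hP
    have hmono : Monotone a := by
      intro i j hij
      rcases hij.eq_or_lt with rfl | hlt
      · exact le_rfl
      · exact ((hG1 _).trans (ha _ _ hlt)).le
    obtain ⟨x0, hx0⟩ := hb (a '' K) ((mk_image_le.trans (mk_set_le _)).trans_lt hP)
    obtain ⟨x, hx, hxmin⟩ := (wellFounded_lt (α := ι)).has_min
      {x | ∀ y ∈ a '' K, y < x} ⟨x0, hx0⟩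
    have hc : ∀ c < x, ∃ j ∈ K, c ≤ a j := by
      intro c hcx
      by_contra hno
      push Not at hno
      refine hxmin c ?_ hcx
      rintro _ ⟨j, hj, rfl⟩
      exact hno j hj
    have hS : ∃ C, S x C := by
      obtain ⟨k, hk⟩ := hne
      refine ⟨fun i => if i ∈ K then a i else a k, ?_, ?_⟩
      · intro i
        dsimp only
        split_ifs with hi
        · exact hx _ ⟨i, hi, rfl⟩
        · exact hx _ ⟨k, hk, rfl⟩
      · intro c hcx
        obtain ⟨j, hj, hcj⟩ := hc c hcx
        refine ⟨j, hj, fun i hi hle => ?_⟩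
        simp only [if_pos hi]
        exact hcj.trans (hmono hle)
    have hC := hS.choose_spec.1 (h x)
    obtain ⟨j, hj, hcj⟩ := hc _ hC
    obtain ⟨j', hj', hjj⟩ := hmax j hj
    have h1 : x < f (h x) (Sum.inl (hS.choose (h x))) :=
      hf _ _ x ⟨rfl, by simp only [g, dif_pos hS]⟩
    have h2 := hG2 (a j) (h x) _ hcj
    have h3 := ha _ _ hjj
    have h4 := hx _ ⟨j', hj', rfl⟩
    exact lt_irrefl _ (((h1.trans h2).trans h3).trans h4)

/-- Maximal antichains inside a dense set. -/
theorem aux_maxAntichain (N : Set B) (hN : ∀ b : B, b ≠ ⊥ → ∃ c ∈ N, c ≠ ⊥ ∧ c ≤ b) :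
    ∃ W : Set B, W ⊆ N ∧ IsAntichainIn W ∧ ∀ b : B, b ≠ ⊥ → ∃ w ∈ W, b ⊓ w ≠ ⊥ := by
  obtain ⟨W, hW⟩ := zorn_subset {W : Set B | W ⊆ N ∧ IsAntichainIn W} (by
    intro c hc hch
    refine ⟨⋃₀ c, ⟨Set.sUnion_subset fun s hs => (hc hs).1, ?_, ?_⟩,
      fun s hs => Set.subset_sUnion_of_mem hs⟩
    · rintro a ⟨s, hs, ha⟩
      exact (hc hs).2.1 a ha
    · rintro a ⟨s, hs, ha⟩ b ⟨t, ht, hb⟩ hab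
      rcases hch.total hs ht with h | h
      · exact (hc ht).2.2 (h ha) hb hab
      · exact (hc hs).2.2 ha (h hb) hab)
  refine ⟨W, hW.prop.1, hW.prop.2, ?_⟩
  intro b hb
  by_contra hcon
  push Not at hcon
  obtain ⟨c, hcN, hc0, hcb⟩ := hN b hb
  have hcw : ∀ w ∈ W, c ⊓ w = ⊥ := fun w hw =>
    le_bot_iff.mp ((inf_le_inf_right w hcb).trans (hcon w hw).le)
  have hins : insert c W ∈ {W : Set B | W ⊆ N ∧ IsAntichainIn W} := by
    refine ⟨Set.insert_subset hcN hW.prop.1, ?_, ?_⟩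
    · rintro a (rfl | ha)
      · exact hc0
      · exact hW.prop.2.1 a ha
    · rintro a (rfl | ha) b' (rfl | hb') hab
      · exact absurd rfl hab
      · exact hcw _ hb'
      · rw [inf_comm]; exact hcw _ ha
      · exact hW.prop.2.2 ha hb' hab
  have hmem : c ∈ W := hW.le_of_ge hins (Set.subset_insert _ _) (Set.mem_insert _ _)
  exact hc0 (by simpa using hcw c hmem)

/-- There is an antichain of size n below b. -/
def AuxH (b : B) (n : Cardinal.{u}) : Prop :=
  ∃ X : Set B, IsAntichainIn X ∧ (∀ x ∈ X, x ≤ b) ∧ Cardinal.mk X = n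

theorem AuxH.mono {b : B} {n m : Cardinal.{u}} (h : AuxH b n) (hm : m ≤ n) : AuxH b m := by
  obtain ⟨X, hX, hb, rfl⟩ := h
  obtain ⟨Y, hY, rfl⟩ := Cardinal.le_mk_iff_exists_subset.mp hm
  exact ⟨Y, ⟨fun a ha => hX.1 a (hY ha), hX.2.mono hY⟩, fun a ha => hb a (hY ha), rfl⟩

open Cardinal in
theorem aux_glue {I : Type u} (b : I → B) (hb : ∀ i j, i ≠ j → b i ⊓ b j = ⊥)
    (n : I → Cardinal.{u}) (hH : ∀ i, AuxH (b i) (n i)) (lam : Cardinal.{u})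
    (hsucc : ∀ m < lam, Order.succ m < lam)
    (hlam : ∀ m < lam, ∃ i, m ≤ n i) : AuxH (⊤ : B) lam := by
  choose X hX hXb hXn using hH
  have hdis : ∀ i j, i ≠ j → ∀ x ∈ X i, ∀ y ∈ X j, x ⊓ y = ⊥ := fun i j hij x hx y hy =>
    le_bot_iff.mp ((inf_le_inf (hXb i x hx) (hXb j y hy)).trans (hb i j hij).le)
  have h1 : AuxH (⊤ : B) (Cardinal.sum n) := by
    refine ⟨⋃ i, X i, ⟨?_, ?_⟩, fun _ _ => le_top, ?_⟩
    · intro a ha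
      obtain ⟨i, hi⟩ := Set.mem_iUnion.mp ha
      exact (hX i).1 a hi
    · intro x hx y hy hxy
      obtain ⟨i, hi⟩ := Set.mem_iUnion.mp hx
      obtain ⟨j, hj⟩ := Set.mem_iUnion.mp hy
      by_cases hij : i = j
      · subst hij
        exact (hX i).2 hi hj hxy
      · exact hdis i j hij x hi y hj
    · rw [mk_iUnion_eq_sum_mk]
      · simp only [hXn]
      · intro i j hij
        rw [Function.onFun, Set.disjoint_left]
        intro x hx hx'
        exact (hX i).1 x hx (by simpa using hdis i j hij x hx x hx')
  refine h1.mono (le_of_forall_lt fun m hm => ?_)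
  obtain ⟨i, hi⟩ := hlam _ (hsucc m hm)
  exact (Order.lt_succ m).trans_le (hi.trans (le_sum n i))

open Cardinal in
/-- The Erdos-Tarski theorem. -/
theorem aux_ET (lam : Cardinal.{u}) (hinf : ℵ₀ ≤ lam) (h1 : ∀ n < lam, AuxH (⊤ : B) n)
    (h2 : ¬ AuxH (⊤ : B) lam) : lam.IsRegular := by
  classical
  refine Cardinal.IsRegular.of_not_isSingular hinf fun hsing => h2 ?_
  have hsucc : ∀ m < lam, Order.succ m < lam := fun m hm => hsing.isSuccLimit.succ_lt hm
  by_cases hcase : ∃ b : B, b ≠ ⊥ ∧ ∀ b' : B, b' ≠ ⊥ → b' ≤ b → ∀ n < lam, AuxH b' n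
  · obtain ⟨b, hb0, hb⟩ := hcase
    obtain ⟨I, f, hf, hI⟩ := Ordinal.exists_lsub_cof lam.ord
    obtain ⟨X, hX, hXb, hXn⟩ := hb b hb0 le_rfl _ hsing.cof_ord_lt
    obtain ⟨eq⟩ := Cardinal.eq.mp (hI.trans hXn.symm)
    have hfl : ∀ i, (f i).card < lam := fun i =>
      Cardinal.lt_ord.mp (hf ▸ Ordinal.lt_lsub f i)
    refine aux_glue (fun i => (eq i : B)) ?_ (fun i => (f i).card)
      (fun i => hb _ (hX.1 _ (eq i).2) (hXb _ (eq i).2) _ (hfl i)) lam hsucc ?_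
    · intro i j hij
      exact hX.2 (eq i).2 (eq j).2 fun h => hij (eq.injective (Subtype.ext h))
    · intro m hm
      have : m.ord < Ordinal.lsub f := by rw [hf]; exact Cardinal.ord_lt_ord.mpr hm
      obtain ⟨i, hi⟩ := Ordinal.lt_lsub_iff.mp this
      exact ⟨i, by simpa using Ordinal.card_le_card hi⟩
  · push Not at hcase
    obtain ⟨W, hWN, hWa, hWd⟩ := aux_maxAntichain {b : B | ∃ n < lam, ¬ AuxH b n} (by
      intro b hb
      obtain ⟨b', h0, hle, n, hn, hH⟩ := hcase b hb
      exact ⟨b', ⟨n, hn, hH⟩, h0, hle⟩)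
    have hWlt : #W < lam := by
      by_contra hcon
      exact h2 (AuxH.mono ⟨W, hWa, fun _ _ => le_top, rfl⟩ (not_lt.mp hcon))
    have hbig : ∀ n < lam, ∃ w : W, AuxH (w : B) n := by
      intro n hn
      set r := max ℵ₀ (max n #W) with hr
      have hal : ℵ₀ < lam := lt_of_le_of_ne hinf fun h =>
        Cardinal.not_isSingular_aleph0 (h ▸ hsing)
      have hrlt : r < lam := max_lt hal (max_lt hn hWlt)
      obtain ⟨X, hX, -, hXn⟩ := h1 _ (hsucc r hrlt)
      have hch : ∀ x : X, ∃ w : W, (x : B) ⊓ w ≠ ⊥ := fun x => by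
        obtain ⟨w, hw, h⟩ := hWd x (hX.1 x x.2)
        exact ⟨⟨w, hw⟩, h⟩
      choose F hF using hch
      have hreg : (Order.succ r).IsRegular := Cardinal.isRegular_succ (le_max_left _ _)
      obtain ⟨w, hw⟩ := Cardinal.infinite_pigeonhole F
        (by rw [hXn]; exact hreg.aleph0_le)
        (by rw [hXn, hreg.cof_ord]
            exact ((le_max_right _ _).trans (le_max_right _ _)).trans_lt (Order.lt_succ r))
      refine ⟨w, AuxH.mono (n := Order.succ r) ?_
        (((le_max_left _ _).trans (le_max_right _ _)).trans (Order.le_succ r))⟩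
      have hdis : ∀ x y : X, x ≠ y → ((x : B) ⊓ w) ⊓ ((y : B) ⊓ w) = ⊥ := by
        intro x y hxy
        refine le_bot_iff.mp ((inf_le_inf inf_le_left inf_le_left).trans
          (hX.2 x.2 y.2 fun h => hxy (Subtype.ext h)).le)
      have hne : ∀ x : X, F x = w → (x : B) ⊓ w ≠ ⊥ := fun x hx => hx ▸ hF x
      refine ⟨Set.range fun x : F ⁻¹' {w} => ((x : X) : B) ⊓ w, ⟨?_, ?_⟩, ?_, ?_⟩
      · rintro _ ⟨x, rfl⟩
        exact hne x x.2
      · rintro _ ⟨x, rfl⟩ _ ⟨y, rfl⟩ hxy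
        exact hdis x y fun h => hxy (by simp only [h])
      · rintro _ ⟨x, rfl⟩
        exact inf_le_right
      · rw [mk_range_eq, hw, hXn]
        intro x y hxy
        by_contra hne'
        have := hdis x y fun h => hne' (Subtype.ext h)
        simp only at hxy
        rw [hxy, inf_idem] at this
        exact hne y y.2 this
    let t : W → Cardinal.{u} := fun w => sInf {n | ¬ AuxH (w : B) n}
    have ht1 : ∀ w n, n < t w → AuxH (w : B) n := fun w n hn => by
      by_contra hcon
      exact notMem_of_lt_csInf' hn hcon
    have ht2 : ∀ w : W, t w < lam ∧ ¬ AuxH (w : B) (t w) := fun w => by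
      obtain ⟨n, hn, hH⟩ := hWN w.2
      exact ⟨(csInf_le' hH).trans_lt hn, csInf_mem (s := {n | ¬ AuxH (w : B) n}) ⟨n, hH⟩⟩
    have ht3 : ∀ (w : W) n, AuxH (w : B) n → n < t w := fun w n hn => by
      by_contra hcon
      exact (ht2 w).2 (hn.mono (not_lt.mp hcon))
    have hn : ∀ w : W, ∃ n, AuxH (w : B) n ∧
        ∀ v : W, (t v < t w ∧ ∀ v' : W, t v' < t w → t v' ≤ t v) → t v ≤ n := by
      intro w
      by_cases h : ∃ v : W, t v < t w ∧ ∀ v' : W, t v' < t w → t v' ≤ t v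
      · obtain ⟨v, hv, hv'⟩ := h
        exact ⟨t v, ht1 w _ hv, fun v1 h1 => hv' v1 h1.1⟩
      · refine ⟨0, ⟨∅, ⟨by simp, by simp⟩, by simp, by simp⟩, fun v hv => absurd ⟨v, hv⟩ h⟩
    choose n hnH hn using hn
    refine aux_glue (fun w : W => (w : B))
      (fun i j hij => hWa.2 i.2 j.2 fun h => hij (Subtype.ext h)) n hnH lam hsucc ?_
    intro m hm
    obtain ⟨w, hw⟩ := hbig m hm
    obtain ⟨w1, hw1⟩ := hbig _ (ht2 w).1
    obtain ⟨v, hv, hvmin⟩ := (InvImage.wf t (wellFounded_lt (α := Cardinal.{u}))).has_min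
      {v | t w < t v} ⟨w1, ht3 _ _ hw1⟩
    refine ⟨v, (ht3 _ _ hw).le.trans (hn v w ⟨hv, fun v' hv' => ?_⟩)⟩
    by_contra hcon
    exact hvmin v' (not_le.mp hcon) hv'

open Cardinal in
theorem aux_order {ι : Type u} (h : (#ι).IsRegular) :
    ∃ (_ : LinearOrder ι) (_ : WellFoundedLT ι),
      (∀ s : Set ι, #s < #ι → ∃ x, ∀ y ∈ s, y < x) ∧ ∀ x : ι, #(Set.Iic x) < #ι := by
  obtain ⟨_, _, hα⟩ := exists_ord_eq_type_lt ι
  refine ⟨inferInstance, inferInstance, ?_, ?_⟩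
  · intro s hs
    rw [← not_isCofinal_iff]
    intro hc
    have h1 := Order.cof_le hc
    rw [← Ordinal.cof_type, ← hα, h.cof_ord] at h1
    exact absurd hs (not_lt.mpr h1)
  · intro x
    exact mk_Iic_lt x hα h.aleph0_le

theorem aux_iSup_meet {B : Type*} [CompleteBooleanAlgebra B] {P : Type*} (p : P → B)
    (hp : ⨆ i, p i = ⊤) (c : B) (hc : c ≠ ⊥) :
    ∃ i, c ⊓ p i ≠ ⊥ := by
  by_contra hcon
  push Not at hcon
  apply hc
  rw [← inf_top_eq c, ← hp, inf_iSup_eq]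
  simp [hcon]

open Cardinal in
theorem aux_partition (U : Set B) (hU : IsUltra U) (hnp : sInf U = ⊥) :
    ∃ (P : Type u) (_ : LinearOrder P) (_ : WellFoundedLT P) (p : P → B) (K : Set P),
      (∀ n : Cardinal.{u}, ¬ AuxH (⊤ : B) n → #P < n) ∧
      (∀ i j, i ≠ j → p i ⊓ p j = ⊥) ∧ (⨆ i, p i = ⊤) ∧ K.Nonempty ∧
      (∀ j ∈ K, ∃ j' ∈ K, j < j') ∧ (⨆ i : K, p i) ∈ U ∧
      ∀ j ∈ K, (⨆ i : Set.Iic j, p i) ∉ U := by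
  classical
  obtain ⟨hT, hB, hup, hinf, hul⟩ := hU
  have hcompl : ∀ a, a ∉ U → aᶜ ∈ U := fun a ha => (hul a).resolve_left ha
  have hprime : ∀ a b, a ⊔ b ∈ U → a ∉ U → b ∈ U := fun a b hab ha => by
    refine hup _ (hinf _ hab _ (hcompl a ha)) _ ?_
    rw [inf_sup_right]
    simp
  obtain ⟨W, hWN, hWa, hWd⟩ := aux_maxAntichain Uᶜ (by
    intro b hb
    have : ∃ a ∈ U, ¬ b ≤ a := by
      by_contra hcon
      push Not at hcon
      exact hb (le_bot_iff.mp (hnp ▸ le_sInf hcon))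
    obtain ⟨a, ha, hba⟩ := this
    refine ⟨b \ a, fun h => hB (hup _ (hinf _ h _ ha) _ (by simp)), ?_, sdiff_le⟩
    rwa [Ne, sdiff_eq_bot_iff])
  have hsup : ⨆ i : W, (i : B) = ⊤ := by
    by_contra hcon
    obtain ⟨w, hw, h⟩ := hWd (⨆ i : W, (i : B))ᶜ (by rwa [Ne, compl_eq_bot])
    apply h
    refine le_bot_iff.mp ((inf_le_inf_left _ (le_iSup (fun i : W => (i : B)) ⟨w, hw⟩)).trans ?_)
    simp
  obtain ⟨P, p, hpU, hsup, hcard, hdis⟩ : ∃ (P : Type u) (p : P → B), (∀ i, p i ∉ U) ∧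
      (⨆ i, p i = ⊤) ∧ (∀ n : Cardinal.{u}, ¬ AuxH (⊤ : B) n → #P < n) ∧
      (∀ i j, i ≠ j → p i ⊓ p j = ⊥) := by
    refine ⟨W, fun i => (i : B), fun i => hWN i.2, hsup, ?_, ?_⟩
    · intro n hn
      by_contra hcon
      exact hn (AuxH.mono ⟨W, hWa, fun _ _ => le_top, rfl⟩ (not_lt.mp hcon))
    · intro i j hij
      exact hWa.2 i.2 j.2 fun h => hij (Subtype.ext h)
  obtain ⟨_, _, -⟩ := exists_ord_eq_type_lt P
  let K : Set P := {j | (⨆ i : Set.Iic j, p i) ∉ U}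
  have hKU : (⨆ i : K, p i) ∈ U := by
    by_cases hall : ∀ j : P, j ∈ K
    · refine hup _ hT _ ?_
      rw [← hsup]
      exact iSup_le fun i => le_iSup (fun i : K => p i) ⟨i, hall i⟩
    · push Not at hall
      obtain ⟨j, hj, hmin⟩ := (wellFounded_lt (α := P)).has_min {j | j ∉ K} hall
      have hj' : (⨆ i : Set.Iic j, p i) ∈ U := not_not.mp hj
      refine hprime (p j) _ (hup _ hj' _ (iSup_le fun i => ?_)) (hpU j)
      rcases eq_or_lt_of_le i.2 with h | h
      · rw [h]; exact le_sup_left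
      · refine le_sup_of_le_right (le_iSup (fun i : K => p i) ⟨i, ?_⟩)
        by_contra hno
        exact hmin _ hno h
  refine ⟨P, inferInstance, inferInstance, p, K, hcard, hdis, hsup, ?_, ?_, hKU,
    fun j hj => hj⟩
  · by_contra h
    apply hB
    refine hup _ hKU _ (iSup_le fun i => ?_)
    exact absurd ⟨i.1, i.2⟩ h
  · intro j hj
    by_contra hcon
    push Not at hcon
    apply hj
    refine hup _ hKU _ (iSup_le fun i => ?_)
    exact le_iSup (fun i : Set.Iic j => p i) ⟨i, hcon i i.2⟩

open Cardinal in
theorem statement13 {B : Type u} [CompleteBooleanAlgebra B]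
    (U : Set B) (hU : IsUltra U) (hnp : sInf U = ⊥)
    (lam : Cardinal.{u}) (hlam : lam = ccOf B)
    (ι : Type u) (hι : Cardinal.mk ι = lam) :
    ∃ A : Finset ι → B, IsDistribution A ∧ (∀ s, A s ∈ U) ∧
      IsDeltaDistribution A deltaTP2 ∧
      ∀ (B' : Type v) [CompleteBooleanAlgebra B'] (e : B → B'),
        IsCompleteEmbedding e →
        (∀ A' : Set B', IsAntichainIn A' →
          Cardinal.lift.{u} (Cardinal.mk A') < Cardinal.lift.{v} lam) →
        ¬ ∃ D : Finset ι → B', IsDistribution D ∧ IsMultiplicative D ∧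
            ∀ s : Finset ι, D s ≤ e (A s) := by
  classical
  subst hι
  have hc1 : ∀ n < #ι, AuxH (⊤ : B) n := fun n hn => by
    rw [hlam] at hn
    have := notMem_of_lt_csInf' hn
    obtain ⟨X, hX, h⟩ := not_not.mp this
    exact ⟨X, hX, fun _ _ => le_top, h⟩
  have hc2 : ¬ AuxH (⊤ : B) #ι := by
    rintro ⟨X, hX, -, h⟩
    have : ccOf B ∈ {κ : Cardinal.{u} | ¬ ∃ A : Set B, IsAntichainIn A ∧ #A = κ} := by
      refine csInf_mem ⟨Order.succ #B, ?_⟩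
      rintro ⟨A, -, hA⟩
      exact absurd (hA ▸ mk_set_le A) (not_le.mpr (Order.lt_succ _))
    exact this ⟨X, hX, h.trans hlam⟩
  obtain ⟨P, _, _, p, K, hPn, hdis, hsup, hKne, hKmax, hKU, hKj⟩ := aux_partition U hU hnp
  have hP : #P < #ι := hPn _ hc2
  have hinf : ℵ₀ ≤ #ι := by
    refine le_trans ?_ hP.le
    rw [← infinite_iff]
    have : Infinite K := by
      have : Nonempty K := hKne.to_subtype
      have : NoMaxOrder K := ⟨fun a => by
        obtain ⟨j, hj, h⟩ := hKmax a a.2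
        exact ⟨⟨j, hj⟩, h⟩⟩
      exact NoMaxOrder.infinite
    exact Infinite.of_injective _ (Subtype.val_injective (p := (· ∈ K)))
  have hreg := aux_ET (B := B) #ι hinf hc1 hc2
  obtain ⟨_, _, hb, hfin⟩ := aux_order hreg
  obtain ⟨g, hg1, hg2⟩ := aux_comb hb hfin hinf hP K hKne hKmax
  obtain ⟨hT, hB, hup, hmeet, hul⟩ := hU
  let A : Finset ι → B := fun s => ⨆ i : {i : P // Set.InjOn (g i) s}, p i
  have hA1 : ∀ i (s : Finset ι), Set.InjOn (g i) s → p i ≤ A s := fun i s h =>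
    le_iSup (fun i : {i : P // Set.InjOn (g i) s} => p i) ⟨i, h⟩
  have hA2 : ∀ i (s : Finset ι), ¬ Set.InjOn (g i) s → A s ⊓ p i = ⊥ := fun i s h => by
    simp only [A, iSup_inf_eq]
    refine le_bot_iff.mp (iSup_le fun j => ?_)
    exact (hdis j i fun hij => h (by rw [← hij]; exact j.2)).le
  have hAU : ∀ s, A s ∈ U := by
    intro s
    have h1 : ∀ T : Finset (ι × ι), ∃ i₀ ∈ K, ∀ i ∈ K, i₀ ≤ i →
        ∀ q ∈ T, q.1 ≠ q.2 → g i q.1 ≠ g i q.2 := by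
      intro T
      induction T using Finset.induction_on with
      | empty => 
        obtain ⟨k, hk⟩ := hKne
        exact ⟨k, hk, by simp⟩
      | insert a T _ ih =>
        obtain ⟨i₀, h0, h1⟩ := ih
        by_cases ha : a.1 = a.2
        · refine ⟨i₀, h0, fun i hi hle q hq hne => ?_⟩
          rcases Finset.mem_insert.mp hq with rfl | hq
          · exact absurd ha hne
          · exact h1 i hi hle q hq hne
        · obtain ⟨i₁, h2, h3⟩ := hg1 _ _ ha
          refine ⟨max i₀ i₁, by rcases max_choice i₀ i₁ with h | h <;> rwa [h],
            fun i hi hle q hq hne => ?_⟩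
          rcases Finset.mem_insert.mp hq with rfl | hq
          · exact h3 i hi ((le_max_right _ _).trans hle)
          · exact h1 i hi ((le_max_left _ _).trans hle) q hq hne
    obtain ⟨i₀, h0, h1⟩ := h1 (s ×ˢ s)
    have hinj : ∀ i ∈ K, i₀ ≤ i → Set.InjOn (g i) s := by
      intro i hi hle x hx y hy hxy
      by_contra hne
      exact h1 i hi hle (x, y) (Finset.mk_mem_product hx hy) hne hxy
    have hc := (hul _).resolve_left (hKj i₀ h0)
    refine hup _ (hmeet _ hKU _ hc) _ ?_
    rw [iSup_inf_eq]
    refine iSup_le fun i => ?_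
    rcases le_total i₀ (i : P) with h | h
    · exact inf_le_left.trans (hA1 _ _ (hinj i i.2 h))
    · refine (inf_le_inf_right _ (le_iSup (fun i : Set.Iic i₀ => p i) ⟨i, h⟩)).trans ?_
      simp
  refine ⟨A, ⟨fun s hs => hB (hs ▸ hAU s), ?_, ?_⟩, hAU, ?_, ?_⟩
  · refine top_le_iff.mp ?_
    rw [← hsup]
    exact iSup_le fun i => hA1 i ∅ (by simp)
  · intro s t hts
    exact iSup_le fun i => hA1 _ _ (i.2.mono (by exact_mod_cast hts))
  · intro s c hc hdec
    obtain ⟨i, hi⟩ := aux_iSup_meet p hsup c hc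
    have hiff : ∀ t ⊆ s, (c ≤ A t ↔ Set.InjOn (g i) t) := by
      intro t ht
      constructor
      · intro h
        by_contra hno
        exact hi (le_bot_iff.mp ((inf_le_inf_right _ h).trans (hA2 i t hno).le))
      · intro h
        refine (hdec t ht).resolve_right fun h' => hi (le_bot_iff.mp ?_)
        exact (inf_le_inf h' (hA1 i t h)).trans (by simp)
    have henc : ∀ {α : Type u} (F : Finset α), ∃ N : α → ℕ, Set.InjOn N F := by
      intro α F
      have := F.countable_toSet
      obtain ⟨N, hN⟩ := Set.countable_iff_exists_injOn.mp this
      exact ⟨N, hN⟩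
    obtain ⟨N, hN⟩ := henc (s.image (g i))
    obtain ⟨M, hM⟩ := henc s
    refine ⟨fun x => (N (g i x), M x), fun t ht => ?_⟩
    rw [hiff t ht]
    constructor
    · intro hinj n m m' h1 h2
      simp only [Finset.mem_image, Prod.mk.injEq] at h1 h2
      obtain ⟨x, hx, hx1, rfl⟩ := h1
      obtain ⟨y, hy, hy1, rfl⟩ := h2
      have : g i x = g i y := hN
        (Finset.mem_coe.mpr (Finset.mem_image_of_mem _ (ht hx)))
        (Finset.mem_coe.mpr (Finset.mem_image_of_mem _ (ht hy))) (hx1.trans hy1.symm)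
      rw [hinj hx hy this]
    · intro hD x hx y hy hxy
      refine hM (ht hx) (ht hy) ?_
      refine hD (N (g i x)) _ _ ?_ ?_
      · simp only [Finset.mem_image, Prod.mk.injEq]
        exact ⟨x, hx, rfl, rfl⟩
      · simp only [Finset.mem_image, Prod.mk.injEq]
        exact ⟨y, hy, by rw [hxy], rfl⟩
  · rintro B' _ e ⟨hinj, heinf, hesup, hecompl, hesSup, hesInf⟩ hcc ⟨D, ⟨hD0, hD1, hD2⟩, hDm, hDA⟩
    have hebot : e ⊥ = ⊥ := by simpa using hesSup ∅
    have hetop : e ⊤ = ⊤ := by simpa using hesInf ∅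
    have hesupp : ⨆ i, e (p i) = ⊤ := by
      have := hesSup (Set.range p)
      rw [sSup_range, hsup, hetop, ← Set.range_comp, sSup_range] at this
      exact this.symm
    choose h hh using fun x => aux_iSup_meet (fun i => e (p i)) hesupp (D {x}) (hD0 {x})
    obtain ⟨i, v, hiv⟩ := hg2 h
    have hne : ∀ x : {x | h x = i ∧ g i x = v}, D {x.1} ⊓ e (p i) ≠ ⊥ := by
      rintro ⟨x, hx, -⟩
      have := hh x
      rwa [hx] at this
    have hdj : ∀ x y : {x | h x = i ∧ g i x = v}, x ≠ y →
        (D {x.1} ⊓ e (p i)) ⊓ (D {y.1} ⊓ e (p i)) = ⊥ := by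
      rintro ⟨x, hx, hx'⟩ ⟨y, hy, hy'⟩ hxy
      have hxy' : x ≠ y := fun h => hxy (Subtype.ext h)
      have h1 : D {x, y} = D {x} ⊓ D {y} := by
        rw [hDm {x, y}]
        simp [Finset.inf_insert]
      have h2 : A {x, y} ⊓ p i = ⊥ := hA2 i _ fun hI =>
        hxy' (hI (by simp) (by simp) (hx'.trans hy'.symm))
      have h3 : D {x, y} ⊓ e (p i) = ⊥ := by
        refine le_bot_iff.mp ((inf_le_inf_right _ (hDA _)).trans ?_)
        rw [← heinf, h2, hebot]
      rw [← inf_inf_distrib_right, ← h1, h3]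
    have hinj' : Function.Injective
        (fun x : {x | h x = i ∧ g i x = v} => D {x.1} ⊓ e (p i)) := by
      intro x y hxy
      by_contra hno
      have h1 := hdj x y hno
      simp only at hxy
      rw [hxy, inf_idem] at h1
      exact hne y h1
    have hfinal := hcc (Set.range fun x : {x | h x = i ∧ g i x = v} => D {x.1} ⊓ e (p i))
      ⟨by rintro _ ⟨x, rfl⟩; exact hne x, by
        rintro _ ⟨x, rfl⟩ _ ⟨y, rfl⟩ hxy
        exact hdj x y fun h => hxy (by simp only [h])⟩
    rw [mk_range_eq_of_injective hinj', hiv] at hfinal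
    exact lt_irrefl _ hfinal

end BA
end
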